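/- arXiv:0909.0219 — 3 statements merged into one kernel-verified Lean document; each statement's English description precedes it below -/
import Mathlib

section
/- Let r₁ ≤ r₃ < r₄ ≤ r₂, and let c₀, c₁, T, G, A be positive real numbers. Let g : (0,c₀) → (0,+∞) be continuous with lim_{σ→0⁺} g(σ)/√σ = G. Let f : (r₁,r₂)×(0,T)×[−c₁,c₁]² → ℝ satisfy lim_{σ→0⁺} sup{ |f(r,t,p,q)| : (r,t) ∈ (r₁,r₂)×(0,T), (p,q) ∈ [−σ,σ]² } = 0. Let v : (r₁,r₂)×[0,T) → ℝ be such that: (v1) v is continuous; (v2) v(r,t) ≥ 0 everywhere; (v3) v(r,0) > 0 for every r ∈ (r₃,r₄); (v4) the partial derivative v_r(r,t) exists for every (r,t) ∈ (r₁,r₂)×(0,T); (v5) setting 𝒫 := {(r,t) ∈ (r₁,r₂)×(0,T) : 0 < v(r,t) < c₀}, v is of class C^{2,1} on 𝒫 and v_t ≥ g(v)·{v_rr + f(r,t,v,v_r) + A} on 𝒫. Let k₀ := G·√A and 𝒟 := {(r,t) ∈ (r₁,r₂)×[0,T) : r₃ − k₀t < r < r₄ + k₀t}. Then v(r,t) >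 0 for every (r,t) ∈ 𝒟. -/
open Filter Topology

/-- the set `𝒫 = {(r,t) ∈ (r₁,r₂)×(0,T) : 0 < v(r,t) < c₀}` -/
def posSet (r₁ r₂ T c₀ : ℝ) (v : ℝ → ℝ → ℝ) : Set (ℝ × ℝ) :=
  {p : ℝ × ℝ | p.1 ∈ Set.Ioo r₁ r₂ ∧ p.2 ∈ Set.Ioo 0 T ∧
    0 < v p.1 p.2 ∧ v p.1 p.2 < c₀}

/-- At a local minimum the second derivative is nonnegative. -/
theorem IsLocalMin.secondDeriv_nonneg {h h' : ℝ → ℝ} {x d : ℝ} (hmin : IsLocalMin h x)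
    (hd : ∀ᶠ y in 𝓝 x, HasDerivAt h (h' y) y) (hd' : HasDerivAt h' d x) : 0 ≤ d := by
  by_contra! hneg
  have hderiv : deriv h =ᶠ[𝓝 x] h' := hd.mono fun y hy => hy.deriv
  have hdd : deriv (deriv h) x = d := (hd'.congr_of_eventuallyEq hderiv).deriv
  have hmax : IsLocalMax h x :=
    isLocalMax_of_deriv_deriv_neg (by rw [hdd]; exact hneg) hmin.deriv_eq_zero
      hd.self_of_nhds.continuousAt
  have hconst : h =ᶠ[𝓝 x] fun _ => h x := by
    filter_upwards [hmin, hmax] with y h₁ h₂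
    exact le_antisymm h₂ h₁
  have hzero : deriv (deriv h) x = 0 := by
    rw [hconst.deriv.deriv_eq]
    simp
  linarith

/-- The first time at which a continuous function, positive initially, ceases to be positive. -/
theorem exists_first_nonpos_time {F : ℝ × ℝ → ℝ} {a b τ : ℝ}
    (hF : ContinuousOn F (Set.Icc a b ×ˢ Set.Icc 0 τ))
    (h0 : ∀ x ∈ Set.Icc a b, 0 < F (x, 0))
    (hneg : ∃ q ∈ Set.Icc a b ×ˢ Set.Icc 0 τ, F q ≤ 0) :
    ∃ x ∈ Set.Icc a b, ∃ t ∈ Set.Ioc 0 τ, F (x, t) = 0 ∧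
      (∀ y ∈ Set.Icc a b, 0 ≤ F (y, t)) ∧
      ∀ y ∈ Set.Icc a b, ∀ s ∈ Set.Ico 0 t, 0 < F (y, s) := by
  set K := Set.Icc a b ×ˢ Set.Icc 0 τ with hK
  have hKc : IsCompact K := isCompact_Icc.prod isCompact_Icc
  have hZc : IsCompact (K ∩ F ⁻¹' Set.Iic 0) :=
    hKc.of_isClosed_subset (hF.preimage_isClosed_of_isClosed hKc.isClosed isClosed_Iic)
      Set.inter_subset_left
  obtain ⟨q, hq, hqF⟩ := hneg
  obtain ⟨⟨x, t⟩, ⟨⟨hx, ht⟩, hFx⟩, hmin⟩ :=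
    hZc.exists_isMinOn ⟨q, hq, hqF⟩ continuous_snd.continuousOn
  simp only [Set.mem_preimage, Set.mem_Iic] at hx ht hFx
  have htpos : 0 < t := by
    rcases ht.1.eq_or_lt with h | h
    · subst h
      exact absurd (h0 x hx) (not_lt.2 hFx)
    · exact h
  have hbefore : ∀ y ∈ Set.Icc a b, ∀ s ∈ Set.Ico 0 t, 0 < F (y, s) := by
    intro y hy s hs
    by_contra! hle
    have hts : t ≤ s := hmin (show (y, s) ∈ K ∩ F ⁻¹' Set.Iic 0 from
      ⟨⟨hy, hs.1, hs.2.le.trans ht.2⟩, hle⟩)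
    exact absurd hs.2 (not_lt.2 hts)
  have hnow : ∀ y ∈ Set.Icc a b, 0 ≤ F (y, t) := by
    intro y hy
    have hcont : ContinuousWithinAt (fun s => F (y, s)) (Set.Ico 0 t) t :=
      (hF (y, t) ⟨hy, ht⟩).comp (f := fun s : ℝ => (y, s)) (by fun_prop)
        fun s hs => ⟨hy, hs.1, hs.2.le.trans ht.2⟩
    have hcl : t ∈ closure (Set.Ico 0 t) := by
      rw [closure_Ico htpos.ne]
      exact ⟨htpos.le, le_rfl⟩
    have := mem_closure_iff_nhdsWithin_neBot.1 hcl
    exact ge_of_tendsto hcont (eventually_nhdsWithin_of_forall fun s hs => (hbefore y hy s hs).le)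
  exact ⟨x, hx, t, ⟨htpos, ht.2⟩, le_antisymm hFx (hnow x hx), hnow, hbefore⟩

/-- A function positive before `t` and vanishing at `t` has nonpositive derivative at `t`. -/
theorem HasDerivAt.nonpos_of_nonneg_left {h : ℝ → ℝ} {t d : ℝ} (hd : HasDerivAt h d t)
    (h0 : h t = 0) (hpos : ∀ᶠ s in 𝓝[<] t, 0 ≤ h s) : d ≤ 0 := by
  have hs := hd.tendsto_slope.mono_left
    (nhdsWithin_mono t (fun s (hs : s < t) => hs.ne) : 𝓝[<] t ≤ 𝓝[≠] t)
  refine le_of_tendsto hs ?_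
  filter_upwards [hpos, self_mem_nhdsWithin] with s hs hst
  rw [slope_def_field, h0, sub_zero]
  exact div_nonpos_of_nonneg_of_nonpos hs (sub_nonpos.2 (le_of_lt hst))

/-- The concave parabola `b (1 - (x / L)²)` vanishing at `±L`. -/
noncomputable def parabola (b L x : ℝ) : ℝ := b * (1 - (x / L) ^ 2)

/-- The barrier profile `L² (δ u + u^{3/2})` built on `u = parabola b L`; negative outside
`[-L, L]`. -/
noncomputable def barrier (b δ L x : ℝ) : ℝ :=
  L ^ 2 * (parabola b L x * (Real.sqrt (parabola b L x) + δ))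

/-- The derivative of `barrier` on `(-L, L)`. -/
noncomputable def barrierDeriv (b δ L x : ℝ) : ℝ :=
  -2 * b * x * (δ + 3 / 2 * Real.sqrt (parabola b L x))

/-- The second derivative of `barrier` on `(-L, L)`. -/
noncomputable def barrierSecondDeriv (b δ L x : ℝ) : ℝ :=
  -2 * b * (δ + 3 / 2 * Real.sqrt (parabola b L x)) +
    3 / 4 * (2 * b * x / L) ^ 2 / Real.sqrt (parabola b L x)

theorem continuous_barrier (b δ L : ℝ) : Continuous (barrier b δ L) := by
  unfold barrier parabola
  fun_prop

theorem hasDerivAt_parabola (b L x : ℝ) :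
    HasDerivAt (parabola b L) (-2 * b * x / L ^ 2) x := by
  have h := (((((hasDerivAt_id x).div_const L).pow 2).const_sub 1).const_mul b)
  refine h.congr_deriv ?_
  simp only [id, Nat.cast_ofNat]
  ring

theorem hasDerivAt_barrier {b δ L x : ℝ} (hL : L ≠ 0) (hx : 0 < parabola b L x) :
    HasDerivAt (barrier b δ L) (barrierDeriv b δ L x) x := by
  have hu := hasDerivAt_parabola b L x
  have h := ((hu.mul ((hu.sqrt hx.ne').add_const δ)).const_mul (L ^ 2))
  refine h.congr_deriv ?_
  have hm : 0 < Real.sqrt (parabola b L x) := Real.sqrt_pos.2 hx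
  have hsq : parabola b L x = Real.sqrt (parabola b L x) ^ 2 := (Real.sq_sqrt hx.le).symm
  unfold barrierDeriv
  set m := Real.sqrt (parabola b L x)
  rw [hsq]
  field_simp
  ring

theorem hasDerivAt_barrierDeriv {b δ L x : ℝ} (hx : 0 < parabola b L x) :
    HasDerivAt (barrierDeriv b δ L) (barrierSecondDeriv b δ L x) x := by
  have hu := hasDerivAt_parabola b L x
  have h := ((hasDerivAt_id x).const_mul (-2 * b)).mul
    (((hu.sqrt hx.ne').const_mul (3 / 2)).const_add δ)
  refine h.congr_deriv ?_
  have hm : 0 < Real.sqrt (parabola b L x) := Real.sqrt_pos.2 hx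
  simp only [id, barrierSecondDeriv]
  field_simp
  ring

/-- The algebraic inequality making `barrier` a strict subsolution; here `m²` is the value of the
parabola, `p` its slope, `n² = m + δ` and `δ = d²`. -/
theorem barrier_algebraic_ineq {A B κ m n d p : ℝ} (hA : 0 < A) (hB : 98 / 100 * A ≤ B)
    (hκ : 0 ≤ κ) (hκA : κ ^ 2 ≤ 103 / 100 * A) (hm : 0 < m) (hd : 0 < d) (hn : 0 ≤ n)
    (hnm : n ^ 2 = m + d ^ 2) (hp : 0 ≤ p)
    (hcase : 2 * d ^ 2 ≤ m ∨ 4 * κ * d < 3 / 4 * p) :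
    κ * (3 / 2 * m + d ^ 2) * p < n * (3 / 4 * p ^ 2 + B * m) := by
  have hB0 : 0 < B := by linarith
  have hn0 : 0 < n := by
    rcases hn.eq_or_lt with h | h
    · rw [← h] at hnm
      nlinarith
    · exact h
  have hdn : d ≤ n := by
    apply le_of_sq_le_sq _ hn
    nlinarith
  by_cases h2 : 2 * d ^ 2 ≤ m
  · rcases hp.eq_or_lt with h | hp0
    · rw [← h]
      have : 0 < n * (B * m) := by positivity
      nlinarith
    by_contra! hle
    have hsq : (n * (3 / 4 * p ^ 2 + B * m)) ^ 2 ≤ (κ * (3 / 2 * m + d ^ 2) * p) ^ 2 :=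
      pow_le_pow_left₀ (by positivity) hle 2
    have hamgm : 3 * B * m * p ^ 2 ≤ (3 / 4 * p ^ 2 + B * m) ^ 2 := by
      nlinarith [sq_nonneg (3 / 4 * p ^ 2 - B * m)]
    have h1 : (m + d ^ 2) * (3 * B * m) * p ^ 2 ≤ κ ^ 2 * (3 / 2 * m + d ^ 2) ^ 2 * p ^ 2 := by
      calc (m + d ^ 2) * (3 * B * m) * p ^ 2
          = n ^ 2 * (3 * B * m * p ^ 2) := by rw [hnm]; ring
        _ ≤ n ^ 2 * (3 / 4 * p ^ 2 + B * m) ^ 2 := by gcongr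
        _ ≤ _ := by linarith [hsq]
    have h3 := le_of_mul_le_mul_right h1 (by positivity)
    have h4 : κ ^ 2 * (3 / 2 * m + d ^ 2) ^ 2 ≤ 103 / 100 * A * (3 / 2 * m + d ^ 2) ^ 2 := by
      gcongr
    have h5 : (m + d ^ 2) * (3 * (98 / 100 * A) * m) ≤ (m + d ^ 2) * (3 * B * m) := by
      gcongr
    have h6 : A * ((m + d ^ 2) * (294 / 100 * m)) ≤ A * (103 / 100 * (3 / 2 * m + d ^ 2) ^ 2) := by
      linarith
    have h7 := le_of_mul_le_mul_left h6 hA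
    have hd2 : 0 < d ^ 2 := by positivity
    nlinarith
  · have hlt : 4 * κ * d < 3 / 4 * p := hcase.resolve_left h2
    have hp0 : 0 < p := by
      have : 0 ≤ 4 * κ * d := by positivity
      linarith
    have h1 : κ * (3 / 2 * m + d ^ 2) * p ≤ κ * (4 * d ^ 2) * p := by
      gcongr
      linarith
    have h2 : κ * (4 * d ^ 2) * p < d * (3 / 4 * p ^ 2) := by
      have : (4 * κ * d) * (d * p) < 3 / 4 * p * (d * p) := by gcongr
      linarith
    have h3 : d * (3 / 4 * p ^ 2) ≤ n * (3 / 4 * p ^ 2 + B * m) := by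
      gcongr
      have : 0 < B * m := by positivity
      linarith
    linarith

theorem parabola_le {b L : ℝ} (hb : 0 ≤ b) (x : ℝ) : parabola b L x ≤ b := by
  unfold parabola
  nlinarith [mul_nonneg hb (sq_nonneg (x / L))]

theorem abs_le_of_parabola_nonneg {b L x : ℝ} (hb : 0 < b) (hL : 0 < L)
    (hx : 0 ≤ parabola b L x) : |x| ≤ L := by
  have h : 0 ≤ 1 - (x / L) ^ 2 := nonneg_of_mul_nonneg_right hx hb
  have h' : |x / L| ≤ 1 := (sq_le_one_iff_abs_le_one _).1 (by linarith)
  rwa [abs_div, abs_of_pos hL, div_le_one hL] at h'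

theorem barrier_pos {b δ L x : ℝ} (hδ : 0 < δ) (hL : 0 < L) (hx : 0 < parabola b L x) :
    0 < barrier b δ L x := by
  unfold barrier
  have := Real.sqrt_nonneg (parabola b L x)
  positivity

theorem mul_parabola_le_barrier {b δ L x : ℝ} :
    L ^ 2 * (δ * parabola b L x) ≤ barrier b δ L x := by
  unfold barrier
  have h : 0 ≤ parabola b L x * Real.sqrt (parabola b L x) := by
    rcases le_total 0 (parabola b L x) with h | h
    · positivity
    · rw [Real.sqrt_eq_zero_of_nonpos h, mul_zero]
  nlinarith [mul_nonneg (sq_nonneg L) h]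

theorem parabola_nonneg_of_barrier_nonneg {b δ L x : ℝ} (hδ : 0 < δ) (hL : 0 < L)
    (hx : 0 ≤ barrier b δ L x) : 0 ≤ parabola b L x := by
  by_contra! h
  have := Real.sqrt_nonneg (parabola b L x)
  have : barrier b δ L x < 0 := by
    unfold barrier
    exact mul_neg_of_pos_of_neg (by positivity) (mul_neg_of_neg_of_pos h (by positivity))
  linarith

theorem sqrt_parabola_le_one {b L : ℝ} (hb : 0 ≤ b) (hb1 : b ≤ 1) (x : ℝ) :
    Real.sqrt (parabola b L x) ≤ 1 :=
  Real.sqrt_le_one.2 ((parabola_le hb x).trans hb1)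

theorem barrier_le {b δ L : ℝ} (hb : 0 < b) (hb1 : b ≤ 1) (hδ : 0 < δ) (hδ1 : δ ≤ 1)
    (x : ℝ) : barrier b δ L x ≤ 2 * L ^ 2 := by
  have hm := sqrt_parabola_le_one (L := L) hb.le hb1 x
  have hm0 := Real.sqrt_nonneg (parabola b L x)
  have h1 := (parabola_le (L := L) hb.le x).trans hb1
  have : parabola b L x * (Real.sqrt (parabola b L x) + δ) ≤ 1 * 2 :=
    (mul_le_mul_of_nonneg_right h1 (by positivity)).trans (by linarith)
  unfold barrier
  nlinarith [sq_nonneg L]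

theorem abs_barrierDeriv_le {b δ L x : ℝ} (hb : 0 < b) (hb1 : b ≤ 1) (hδ : 0 < δ)
    (hδ1 : δ ≤ 1) (hx : |x| ≤ L) : |barrierDeriv b δ L x| ≤ 5 * L := by
  have hm := sqrt_parabola_le_one (L := L) hb.le hb1 x
  have hm0 := Real.sqrt_nonneg (parabola b L x)
  have hL : 0 ≤ L := (abs_nonneg x).trans hx
  unfold barrierDeriv
  rw [abs_mul, abs_mul, abs_mul, abs_of_pos hb,
    abs_of_pos (show 0 < δ + 3 / 2 * Real.sqrt (parabola b L x) by positivity)]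
  norm_num
  calc 2 * b * |x| * (δ + 3 / 2 * Real.sqrt (parabola b L x))
      ≤ 2 * 1 * L * (1 + 3 / 2 * 1) := by gcongr
    _ = 5 * L := by ring

/-- Comparison with a travelling barrier: it suffices to exclude interior contact at points where
the barrier is positive. -/
theorem barrier_lt_of_no_contact {r₁ r₂ T c₀ b δ L r₀ k τ : ℝ} {v vr vrr vt : ℝ → ℝ → ℝ}
    (hb : 0 < b) (hδ : 0 < δ) (hL : 0 < L) (hτ : τ < T)
    (hv1 : ContinuousOn (fun p : ℝ × ℝ => v p.1 p.2) (Set.Ioo r₁ r₂ ×ˢ Set.Ico 0 T))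
    (hv2 : ∀ r t : ℝ, r ∈ Set.Ioo r₁ r₂ → t ∈ Set.Ico 0 T → 0 ≤ v r t)
    (hv4 : ∀ r t : ℝ, r ∈ Set.Ioo r₁ r₂ → t ∈ Set.Ioo 0 T →
      HasDerivAt (fun ρ => v ρ t) (vr r t) r)
    (hvrr : ∀ r t : ℝ, (r, t) ∈ posSet r₁ r₂ T c₀ v →
      HasDerivAt (fun ρ => vr ρ t) (vrr r t) r)
    (hvt : ∀ r t : ℝ, (r, t) ∈ posSet r₁ r₂ T c₀ v →
      HasDerivAt (fun s => v r s) (vt r t) t)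
    (htube : ∀ t ∈ Set.Icc 0 τ, ∀ x ∈ Set.Icc (-(2 * L)) (2 * L),
      r₀ + k * t + x ∈ Set.Ioo r₁ r₂)
    (hinit : ∀ x ∈ Set.Icc (-(2 * L)) (2 * L), barrier b δ L x < v (r₀ + x) 0)
    (hsmall : ∀ x, barrier b δ L x < c₀)
    (hsub : ∀ r t x, (r, t) ∈ posSet r₁ r₂ T c₀ v → 0 < parabola b L x →
      v r t = barrier b δ L x → vr r t = barrierDeriv b δ L x →
      barrierSecondDeriv b δ L x ≤ vrr r t → -k * barrierDeriv b δ L x < vt r t) :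
    ∀ t ∈ Set.Icc 0 τ, ∀ x ∈ Set.Icc (-(2 * L)) (2 * L),
      barrier b δ L x < v (r₀ + k * t + x) t := by
  by_contra! hcon
  obtain ⟨t', ht', x', hx', hle⟩ := hcon
  obtain ⟨x, hx, t, ht, hF0, hFnow, hFbefore⟩ :=
    exists_first_nonpos_time
      (F := fun q : ℝ × ℝ => v (r₀ + k * q.2 + q.1) q.2 - barrier b δ L q.1)
      (a := -(2 * L)) (b := 2 * L) (τ := τ)
      (by
        refine ContinuousOn.sub ?_ ((continuous_barrier b δ L).comp continuous_fst).continuousOn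
        exact hv1.comp (f := fun q : ℝ × ℝ => (r₀ + k * q.2 + q.1, q.2)) (by fun_prop)
          fun q hq => ⟨htube _ hq.2 _ hq.1, hq.2.1, hq.2.2.trans_lt hτ⟩)
      (fun x hx => by simpa using hinit x hx)
      ⟨(x', t'), ⟨hx', ht'⟩, by simpa using hle⟩
  simp only at hF0 hFnow hFbefore
  have htT : t ∈ Set.Ioo 0 T := ⟨ht.1, ht.2.trans_lt hτ⟩
  have hrI := htube t ⟨ht.1.le, ht.2⟩ x hx
  set r := r₀ + k * t + x with hr
  have hxr : r - (r₀ + k * t) = x := by rw [hr]; ring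
  have hv0 : 0 ≤ v r t := hv2 r t hrI ⟨htT.1.le, htT.2⟩
  have hvw : v r t = barrier b δ L x := by linarith
  have hu : 0 ≤ parabola b L x := parabola_nonneg_of_barrier_nonneg hδ hL (hvw ▸ hv0)
  have hxL := abs_le.1 (abs_le_of_parabola_nonneg hb hL hu)
  have hshift : ∀ y, HasDerivAt (fun ρ : ℝ => ρ - (r₀ + k * t)) 1 y := fun y =>
    (hasDerivAt_id y).sub_const _
  have hxmem : Set.Icc (-(2 * L)) (2 * L) ∈ 𝓝 x :=
    Icc_mem_nhds (by linarith) (by linarith)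
  have hxmem' : ∀ᶠ ρ in 𝓝 r, ρ - (r₀ + k * t) ∈ Set.Icc (-(2 * L)) (2 * L) :=
    (hshift r).continuousAt.eventually_mem (by rw [hxr]; exact hxmem)
  have hmin : IsLocalMin (fun ρ => v ρ t - barrier b δ L (ρ - (r₀ + k * t))) r := by
    filter_upwards [hxmem'] with ρ hρ
    have := hFnow _ hρ
    rw [show r₀ + k * t + (ρ - (r₀ + k * t)) = ρ by ring] at this
    rw [hxr, hvw, sub_self]
    exact this
  have hdv : ∀ᶠ ρ in 𝓝 r, HasDerivAt (fun ρ => v ρ t) (vr ρ t) ρ := by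
    filter_upwards [Ioo_mem_nhds hrI.1 hrI.2] with ρ hρ
    exact hv4 ρ t hρ htT
  rcases hu.eq_or_lt with hu0 | hupos
  · have hvz : v r t = 0 := by rw [hvw, barrier, ← hu0]; ring
    have hminv : IsLocalMin (fun ρ => v ρ t) r := by
      filter_upwards [Ioo_mem_nhds hrI.1 hrI.2] with ρ hρ
      rw [hvz]
      exact hv2 ρ t hρ ⟨htT.1.le, htT.2⟩
    have hvr0 := hminv.hasDerivAt_eq_zero hdv.self_of_nhds
    have hminl : IsLocalMin
        (fun ρ => v ρ t - L ^ 2 * (δ * parabola b L (ρ - (r₀ + k * t)))) r := by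
      filter_upwards [hmin] with ρ hρ
      rw [hxr, hvw, sub_self] at hρ
      rw [hxr, hvz, ← hu0]
      have := mul_parabola_le_barrier (b := b) (δ := δ) (L := L) (x := ρ - (r₀ + k * t))
      linarith
    have hpar : HasDerivAt (fun ρ => parabola b L (ρ - (r₀ + k * t)))
        (-2 * b * x / L ^ 2) r := by
      have := HasDerivAt.comp r (hasDerivAt_parabola b L (r - (r₀ + k * t))) (hshift r)
      rwa [mul_one, hxr] at this
    have h0 := hminl.hasDerivAt_eq_zero
      (hdv.self_of_nhds.sub ((hpar.const_mul δ).const_mul (L ^ 2)))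
    rw [hvr0] at h0
    have hxz : x = 0 := by
      field_simp at h0
      simpa [hb.ne', hδ.ne', hL.ne'] using h0
    rw [hxz] at hu0
    simp [parabola, hb.ne] at hu0
  · have hpos : (r, t) ∈ posSet r₁ r₂ T c₀ v :=
      ⟨hrI, htT, by simpa only [hvw] using barrier_pos hδ hL hupos,
        by simpa only [hvw] using hsmall x⟩
    have hpc : Continuous (parabola b L) := by unfold parabola; fun_prop
    have hdb : ∀ᶠ ρ in 𝓝 r, HasDerivAt (fun ρ => barrier b δ L (ρ - (r₀ + k * t)))
        (barrierDeriv b δ L (ρ - (r₀ + k * t))) ρ := by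
      have : ∀ᶠ ρ in 𝓝 r, 0 < parabola b L (ρ - (r₀ + k * t)) :=
        (hpc.continuousAt.comp (hshift r).continuousAt).eventually_const_lt
          (by simpa only [Function.comp, hxr] using hupos)
      filter_upwards [this] with ρ hρ
      have := HasDerivAt.comp ρ (hasDerivAt_barrier (δ := δ) hL.ne' hρ) (hshift ρ)
      rwa [mul_one] at this
    have hddb : HasDerivAt (fun ρ => barrierDeriv b δ L (ρ - (r₀ + k * t)))
        (barrierSecondDeriv b δ L x) r := by
      have := HasDerivAt.comp r
        (hasDerivAt_barrierDeriv (δ := δ) (by rw [hxr]; exact hupos)) (hshift r)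
      rwa [mul_one, hxr] at this
    have hd := (hdv.and hdb).mono fun ρ h => h.1.sub h.2
    have hfirst := hmin.hasDerivAt_eq_zero hd.self_of_nhds
    have hsecond := hmin.secondDeriv_nonneg hd ((hvrr r t hpos).sub hddb)
    rw [hxr] at hfirst
    have htlin : HasDerivAt (fun s : ℝ => r - (r₀ + k * s)) (-k) t := by
      simpa using (((hasDerivAt_id t).const_mul k).const_add r₀).const_sub r
    have hdt : HasDerivAt (fun s => v r s - barrier b δ L (r - (r₀ + k * s)))
        (vt r t - barrierDeriv b δ L x * -k) t := by
      refine (hvt r t hpos).sub ?_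
      have := HasDerivAt.comp t
        (hasDerivAt_barrier (δ := δ) hL.ne' (by rw [hxr]; exact hupos)) htlin
      rwa [hxr] at this
    have hle := hdt.nonpos_of_nonneg_left (by simp only [hxr, hvw, sub_self]) (by
      have h1 : ∀ᶠ s in 𝓝[<] t, r - (r₀ + k * s) ∈ Set.Icc (-(2 * L)) (2 * L) :=
        (htlin.continuousAt.eventually_mem (by rw [hxr]; exact hxmem)).filter_mono
          nhdsWithin_le_nhds
      filter_upwards [h1, Ioo_mem_nhdsLT ht.1] with s hs hst
      have := hFbefore _ hs s ⟨hst.1.le, hst.2⟩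
      rw [show r₀ + k * s + (r - (r₀ + k * s)) = r by ring] at this
      exact this.le)
    have := hsub r t x hpos hupos hvw (by linarith) (by linarith)
    linarith

/-- The travelling barrier is a strict subsolution wherever it is positive. -/
theorem barrier_strict_subsolution {A G b d L k x γ φ ξ : ℝ} (hA : 0 < A) (hG : 0 < G)
    (hb : 0 < b) (hb1 : b ≤ 1) (hbA : 500 * b ≤ A) (hd : d = b / (16 + 16 * Real.sqrt A))
    (hL : 0 < L) (hk : k ^ 2 ≤ G ^ 2 * A) (hx : 0 < parabola b L x)
    (hγ : 99 / 100 * G * Real.sqrt (barrier b (d ^ 2) L x) ≤ γ) (hφ : |φ| ≤ A / 100)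
    (hξ : barrierSecondDeriv b (d ^ 2) L x ≤ ξ) :
    -k * barrierDeriv b (d ^ 2) L x < γ * (ξ + φ + A) := by
  have hsA := Real.sqrt_nonneg A
  have hd0 : 0 < d := by rw [hd]; positivity
  have hdb : (16 + 16 * Real.sqrt A) * d = b := by rw [hd]; field_simp
  have hd16 : 16 * d ≤ b := by nlinarith
  have hd1 : d ^ 2 ≤ 1 := by nlinarith
  have hm1 := sqrt_parabola_le_one (L := L) hb.le hb1 x
  have hm : 0 < Real.sqrt (parabola b L x) := Real.sqrt_pos.2 hx
  have hmsq : Real.sqrt (parabola b L x) ^ 2 = parabola b L x := Real.sq_sqrt hx.le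
  have hxL : |x| / L ≤ 1 := (div_le_one hL).2 (abs_le_of_parabola_nonneg hb hL hx.le)
  have hsqw : Real.sqrt (barrier b (d ^ 2) L x) =
      L * (Real.sqrt (parabola b L x) * Real.sqrt (Real.sqrt (parabola b L x) + d ^ 2)) := by
    unfold barrier
    rw [Real.sqrt_mul (by positivity), Real.sqrt_mul hx.le, Real.sqrt_sq hL.le]
  rw [hsqw] at hγ
  unfold barrierSecondDeriv at hξ
  unfold barrierDeriv
  set m := Real.sqrt (parabola b L x) with hmdef
  set n := Real.sqrt (m + d ^ 2)
  have hn : 0 < n := Real.sqrt_pos.2 (by positivity)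
  have hnm : n ^ 2 = m + d ^ 2 := Real.sq_sqrt (by positivity)
  set p := 2 * b * (|x| / L) with hp
  have hp0 : 0 ≤ p := by positivity
  have hpsq : (2 * b * x / L) ^ 2 = p ^ 2 := by
    rw [hp, mul_pow, div_pow |x|, sq_abs]
    ring
  set κ := |k| / (99 / 100 * G) with hκ
  have hκ0 : 0 ≤ κ := by positivity
  have hκk : |k| = κ * (99 / 100 * G) := by rw [hκ]; field_simp
  have hκA : κ ^ 2 ≤ 103 / 100 * A := by
    have h1 : (κ * (99 / 100 * G)) ^ 2 ≤ G ^ 2 * A := by rw [← hκk, sq_abs]; exact hk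
    have h2 : G ^ 2 * (9801 / 10000 * κ ^ 2) ≤ G ^ 2 * A := by linarith
    have := le_of_mul_le_mul_left h2 (by positivity)
    linarith
  have hκ2 : κ ≤ 2 * Real.sqrt A := by
    apply le_of_sq_le_sq _ (by positivity)
    rw [mul_pow, Real.sq_sqrt hA.le]
    linarith
  set B := A - A / 100 - 2 * b * (d ^ 2 + 3 / 2 * m) with hB
  have hBA : 98 / 100 * A ≤ B := by
    have : 2 * b * (d ^ 2 + 3 / 2 * m) ≤ 2 * b * (1 + 3 / 2 * 1) := by gcongr
    linarith
  have hcase : 2 * d ^ 2 ≤ m ∨ 4 * κ * d < 3 / 4 * p := by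
    by_contra! hc
    obtain ⟨hc1, hc2⟩ := hc
    have h1 : parabola b L x ≤ b / 4 := by
      rw [← hmsq]
      calc m ^ 2 ≤ (2 * d ^ 2) ^ 2 := by gcongr
        _ ≤ b / 4 := by nlinarith [mul_le_mul hd1 hd1 (sq_nonneg d) zero_le_one]
    have h2 : 3 / 4 ≤ (|x| / L) ^ 2 := by
      rw [div_pow, sq_abs, ← div_pow]
      unfold parabola at h1
      have : b * (1 - (x / L) ^ 2) ≤ b * (1 / 4) := by linarith
      have := le_of_mul_le_mul_left this hb
      linarith
    have h3 : 1 / 2 ≤ |x| / L := by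
      apply le_of_sq_le_sq _ (by positivity)
      linarith
    have h4 : b ≤ p := by
      calc b = 2 * b * (1 / 2) := by ring
        _ ≤ p := by rw [hp]; gcongr
    have h5 : 4 * κ * d ≤ 4 * (2 * Real.sqrt A) * d := by gcongr
    linarith
  have halg := barrier_algebraic_ineq hA hBA hκ0 hκA hm hd0 hn.le hnm hp0 hcase
  have hB0 : 0 < B := by linarith
  have hξB : 3 / 4 * p ^ 2 / m + B ≤ ξ + φ + A := by
    rw [hpsq] at hξ
    have := (abs_le.1 hφ).1
    linarith
  calc -k * (-2 * b * x * (d ^ 2 + 3 / 2 * m))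
      = k * x * (2 * b * (d ^ 2 + 3 / 2 * m)) := by ring
    _ ≤ |k| * |x| * (2 * b * (d ^ 2 + 3 / 2 * m)) := by
        refine mul_le_mul_of_nonneg_right ?_ (by positivity)
        rw [← abs_mul]
        exact le_abs_self _
    _ = 99 / 100 * G * L * (κ * (3 / 2 * m + d ^ 2) * p) := by
        rw [hκk, hp]
        field_simp
        ring
    _ < 99 / 100 * G * L * (n * (3 / 4 * p ^ 2 + B * m)) := by gcongr
    _ = 99 / 100 * G * (L * (m * n)) * (3 / 4 * p ^ 2 / m + B) := by field_simp
    _ ≤ γ * (ξ + φ + A) := by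
        gcongr
        exact le_trans (by positivity) hγ

theorem exists_pos_mul_lt_of_forall_mem_pos {c : ℝ} (hc : 0 < c) {l : List ℝ}
    (hl : ∀ z ∈ l, 0 < z) : ∃ L > 0, ∀ z ∈ l, c * L < z := by
  induction l with
  | nil => exact ⟨1, one_pos, by simp⟩
  | cons a l ih =>
    rw [List.forall_mem_cons] at hl
    obtain ⟨L, hL, h⟩ := ih hl.2
    refine ⟨min L (a / (2 * c)), lt_min hL (div_pos hl.1 (by positivity)), ?_⟩
    rw [List.forall_mem_cons]
    constructor
    · calc c * min L (a / (2 * c)) ≤ c * (a / (2 * c)) := by gcongr; exact min_le_right _ _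
        _ = a / 2 := by field_simp
        _ < a := half_lt_self hl.1
    · exact fun z hz => lt_of_le_of_lt (by gcongr; exact min_le_left _ _) (h z hz)

/-- Theorem 2.6 / `thm:FBP2`.
For the degenerate, non-Lipschitz forward parabolic differential inequality
`v_t ≥ g(v){v_rr + f(r,t,v,v_r) + A}`, with `g(σ)/√σ → G` as `σ → 0⁺` and `f`
uniformly vanishing as its last two arguments go to `0`, the positivity region
of `v` expands at least at rate `k₀ = G√A`: `v > 0` on
`𝒟 = {(r,t) : r₃ - k₀ t < r < r₄ + k₀ t}`. -/
theorem positivity_region_expands_FBP2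
    (r₁ r₂ r₃ r₄ c₀ c₁ T G A : ℝ)
    (h13 : r₁ ≤ r₃) (h34 : r₃ < r₄) (h42 : r₄ ≤ r₂)
    (hc₀ : 0 < c₀) (hc₁ : 0 < c₁) (hT : 0 < T) (hG : 0 < G) (hA : 0 < A)
    (g : ℝ → ℝ)
    (hgC : ContinuousOn g (Set.Ioo 0 c₀))
    (hgpos : ∀ σ ∈ Set.Ioo (0 : ℝ) c₀, 0 < g σ)
    -- `lim_{σ→0⁺} g(σ)/√σ = G`
    (hglim : Tendsto (fun σ => g σ / Real.sqrt σ) (nhdsWithin 0 (Set.Ioi 0)) (nhds G))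
    (f : ℝ → ℝ → ℝ → ℝ → ℝ)
    -- `f(r,t,0,0) = 0` uniformly in `(r,t)`
    (hf : ∀ ε > (0 : ℝ), ∃ σ > (0 : ℝ), σ ≤ c₁ ∧ ∀ r t p q : ℝ,
      r ∈ Set.Ioo r₁ r₂ → t ∈ Set.Ioo 0 T → |p| ≤ σ → |q| ≤ σ → |f r t p q| ≤ ε)
    (v vr vrr vt : ℝ → ℝ → ℝ)
    -- (v1) `v` is continuous on `(r₁,r₂)×[0,T)`
    (hv1 : ContinuousOn (fun p : ℝ × ℝ => v p.1 p.2) (Set.Ioo r₁ r₂ ×ˢ Set.Ico 0 T))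
    -- (v2) `v ≥ 0`
    (hv2 : ∀ r t : ℝ, r ∈ Set.Ioo r₁ r₂ → t ∈ Set.Ico 0 T → 0 ≤ v r t)
    -- (v3) `v(·,0) > 0` on `(r₃,r₄)`
    (hv3 : ∀ r ∈ Set.Ioo r₃ r₄, 0 < v r 0)
    -- (v4) `v_r` exists on `(r₁,r₂)×(0,T)`
    (hv4 : ∀ r t : ℝ, r ∈ Set.Ioo r₁ r₂ → t ∈ Set.Ioo 0 T →
      HasDerivAt (fun ρ => v ρ t) (vr r t) r)
    -- (v5) `v ∈ C^{2,1}(𝒫)`: on `𝒫` the derivatives `v_rr` and `v_t` exist ...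
    (hvrr : ∀ r t : ℝ, (r, t) ∈ posSet r₁ r₂ T c₀ v →
      HasDerivAt (fun ρ => vr ρ t) (vrr r t) r)
    (hvt : ∀ r t : ℝ, (r, t) ∈ posSet r₁ r₂ T c₀ v →
      HasDerivAt (fun s => v r s) (vt r t) t)
    -- ... and `v_r`, `v_rr`, `v_t` are continuous on `𝒫` ...
    (hvrC : ContinuousOn (fun p : ℝ × ℝ => vr p.1 p.2) (posSet r₁ r₂ T c₀ v))
    (hvrrC : ContinuousOn (fun p : ℝ × ℝ => vrr p.1 p.2) (posSet r₁ r₂ T c₀ v))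
    (hvtC : ContinuousOn (fun p : ℝ × ℝ => vt p.1 p.2) (posSet r₁ r₂ T c₀ v))
    -- ... the arguments of `f` stay in its domain `[-c₁,c₁]²` on `𝒫` ...
    (hdom : ∀ r t : ℝ, (r, t) ∈ posSet r₁ r₂ T c₀ v → |v r t| ≤ c₁ ∧ |vr r t| ≤ c₁)
    -- ... and the inequality `v_t ≥ g(v){v_rr + f(r,t,v,v_r) + A}` holds on `𝒫`
    (hineq : ∀ r t : ℝ, (r, t) ∈ posSet r₁ r₂ T c₀ v →
      g (v r t) * (vrr r t + f r t (v r t) (vr r t) + A) ≤ vt r t) :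
    ∀ r t : ℝ, r ∈ Set.Ioo r₁ r₂ → t ∈ Set.Ico 0 T →
      r₃ - G * Real.sqrt A * t < r → r < r₄ + G * Real.sqrt A * t →
      0 < v r t := by
  intro r t hr ht hrl hru
  rcases ht.1.eq_or_lt with h0 | htpos
  · subst h0
    exact hv3 r ⟨by linarith, by linarith⟩
  set k₀ := G * Real.sqrt A with hk₀
  have hk₀t : 0 < k₀ * t := by positivity
  obtain ⟨r₀, hr₀l, hr₀u⟩ : ∃ r₀, max r₃ (r - k₀ * t) < r₀ ∧ r₀ < min r₄ (r + k₀ * t) :=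
    exists_between (max_lt (lt_min h34 (by linarith)) (lt_min (by linarith) (by linarith)))
  obtain ⟨hr₀3, hr₀k⟩ := max_lt_iff.1 hr₀l
  obtain ⟨hr₀4, hr₀k'⟩ := lt_min_iff.1 hr₀u
  obtain ⟨k, hk⟩ : ∃ k, k * t = r - r₀ := ⟨(r - r₀) / t, by field_simp⟩
  have hkabs : |k| ≤ k₀ := by
    refine le_of_mul_le_mul_right ?_ htpos
    rw [← abs_of_pos htpos, ← abs_mul, abs_of_pos htpos, hk]
    exact abs_le.2 ⟨by linarith, by linarith⟩
  have hksq : k ^ 2 ≤ G ^ 2 * A := by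
    calc k ^ 2 = |k| ^ 2 := (sq_abs k).symm
      _ ≤ k₀ ^ 2 := by gcongr
      _ = G ^ 2 * A := by rw [hk₀, mul_pow, Real.sq_sqrt hA.le]
  obtain ⟨σg, hσg, hg⟩ : ∃ σ > 0, ∀ s ∈ Set.Ioo 0 σ, 99 / 100 * G < g s / Real.sqrt s :=
    mem_nhdsGT_iff_exists_Ioo_subset.1 (hglim.eventually_const_lt (by linarith))
  obtain ⟨σf, hσf, -, hfσ⟩ := hf (A / 100) (by positivity)
  have hr₀I : r₀ ∈ Set.Ioo r₁ r₂ := ⟨by linarith, by linarith⟩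
  obtain ⟨ρ, hρ, hvρ⟩ : ∃ ρ > 0, ∀ y, |y - r₀| < ρ → v r₀ 0 / 2 < v y 0 := by
    have hc : ContinuousAt (fun y => v y 0) r₀ := by
      have : ContinuousOn (fun y => v y 0) (Set.Ioo r₁ r₂) :=
        hv1.comp (f := fun y : ℝ => (y, (0 : ℝ))) (by fun_prop) fun y hy => ⟨hy, le_rfl, hT⟩
      exact this.continuousAt (Ioo_mem_nhds hr₀I.1 hr₀I.2)
    have := hv3 r₀ ⟨hr₀3, hr₀4⟩
    exact Metric.eventually_nhds_iff.1 (hc.eventually_const_lt (half_lt_self this))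
  have hμ := hv3 r₀ ⟨hr₀3, hr₀4⟩
  obtain ⟨L, hL, hLlt⟩ : ∃ L > 0, ∀ z ∈ [1, σg, σf, c₀, ρ, v r₀ 0 / 2, r - r₁, r₂ - r,
      r₀ - r₁, r₂ - r₀], 5 * L < z := by
    refine exists_pos_mul_lt_of_forall_mem_pos (by norm_num) ?_
    have h1 := hr.1
    have h2 := hr.2
    have h3 := hr₀I.1
    have h4 := hr₀I.2
    simp only [List.forall_mem_cons, List.not_mem_nil, false_imp_iff, implies_true, and_true]
    exact ⟨one_pos, hσg, hσf, hc₀, hρ, half_pos hμ, by linarith, by linarith, by linarith,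
      by linarith⟩
  simp only [List.forall_mem_cons, List.not_mem_nil, false_imp_iff, implies_true, and_true]
    at hLlt
  obtain ⟨hL1, hLg, hLf, hLc, hLρ, hLv, hLr₁, hLr₂, hLr₀₁, hLr₀₂⟩ := hLlt
  set b := min 1 (A / 500) with hb_def
  have hb : 0 < b := lt_min one_pos (by positivity)
  have hb1 : b ≤ 1 := min_le_left _ _
  have hbA : 500 * b ≤ A := by linarith [min_le_right 1 (A / 500)]
  set d := b / (16 + 16 * Real.sqrt A) with hd_def
  have hd : 0 < d := by positivity
  have hd1 : d ≤ 1 := by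
    rw [hd_def, div_le_one (by positivity)]
    linarith [Real.sqrt_nonneg A]
  have hδ1 : d ^ 2 ≤ 1 := pow_le_one₀ hd.le hd1
  have hw : ∀ x, barrier b (d ^ 2) L x ≤ 5 * L := fun x =>
    (barrier_le hb hb1 (by positivity) hδ1 x).trans (by nlinarith)
  have hlt := barrier_lt_of_no_contact (δ := d ^ 2) (r₀ := r₀) (k := k) hb (by positivity) hL ht.2
    hv1 hv2 hv4 hvrr hvt
    (by
      intro s hs x hx
      have hθ0 : 0 ≤ s / t := div_nonneg hs.1 htpos.le
      have hθ1 : s / t ≤ 1 := (div_le_one htpos).2 hs.2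
      have hks : k * s = s / t * (r - r₀) := by rw [← hk]; field_simp
      rw [hks]
      generalize s / t = θ at hθ0 hθ1
      have e₁ := mul_le_mul_of_nonneg_left hLr₁.le hθ0
      have e₂ := mul_le_mul_of_nonneg_left hLr₀₁.le (sub_nonneg.2 hθ1)
      have e₃ := mul_le_mul_of_nonneg_left hLr₂.le hθ0
      have e₄ := mul_le_mul_of_nonneg_left hLr₀₂.le (sub_nonneg.2 hθ1)
      exact ⟨by linarith only [e₁, e₂, hx.1, hL], by linarith only [e₃, e₄, hx.2, hL]⟩)
    (by
      intro x hx
      have : |r₀ + x - r₀| < ρ := by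
        rw [add_sub_cancel_left]
        exact abs_lt.2 ⟨by linarith [hx.1], by linarith [hx.2]⟩
      linarith [hvρ _ this, hw x])
    (fun x => (hw x).trans_lt hLc)
    (by
      intro y s x hys hx hvy hvry hvrry
      have hwpos : 0 < barrier b (d ^ 2) L x := barrier_pos (by positivity) hL hx
      have hxL := abs_le_of_parabola_nonneg hb hL hx.le
      refine (barrier_strict_subsolution hA hG hb hb1 hbA hd_def hL hksq hx (γ := g (v y s))
        (φ := f y s (v y s) (vr y s)) ?_ ?_ hvrry).trans_le (hineq y s hys)
      · rw [hvy]
        have := hg _ ⟨hwpos, (hw x).trans_lt hLg⟩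
        exact ((lt_div_iff₀ (Real.sqrt_pos.2 hwpos)).1 this).le
      · refine hfσ y s _ _ hys.1 hys.2.1 ?_ ?_
        · rw [hvy, abs_of_pos hwpos]
          exact (hw x).trans hLf.le
        · rw [hvry]
          exact (abs_barrierDeriv_le hb hb1 (by positivity) hδ1 hxL).trans hLf.le)
  have hfin := hlt t ⟨htpos.le, le_rfl⟩ 0 ⟨by linarith, by linarith⟩
  rw [hk, show r₀ + (r - r₀) + 0 = r by ring] at hfin
  exact (barrier_pos (by positivity) hL (by simpa [parabola] using hb)).trans hfin
end

section
/- Let φ : ℝ → ℝ be a C^∞ even function satisfying φ''(σ) > 0 for all σ ∈ [0,1), φ''(1) = 0, and φ''(σ) < 0 for all σ > 1, and let g(σ) := φ''((φ'|_{[0,1]})⁻¹(φ'(1) − σ)) for σ ∈ (0,φ'(1)). Let U ⊆ (0,+∞)×ℝ be open and let u = u(r,t) be of class C³ on U with 0 < u_r(r,t) < 1 and u_t = φ''(u_r)u_rr + φ'(u_r)/r on U. Then v(r,t) := φ'(1) − φ'(u_r(r,t)) satisfies 0 < v < φ'(1) and v_t = g(v)·{ v_rr + v_r/r − v/r² + φ'(1)/r²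 } on U. In particular, if U ⊆ (r₁,r₂)×(0,T) with r₂ > 0, then v_t ≥ g(v)·{ v_rr + f(r,t,v,v_r) + A } on U with f(r,t,p,q) := q/r − p/r² and A := φ'(1)/r₂². -/
/-- the new unknown `v = φ'(1) - φ'(u_r)` of the change of variables -/
noncomputable def pmV (φ : ℝ → ℝ) (u : ℝ → ℝ → ℝ) (r t : ℝ) : ℝ :=
  deriv φ 1 - deriv φ (deriv (fun ρ => u ρ t) r)

open Filter Topology in
theorem eventually_horizontal_mem {U : Set (ℝ × ℝ)} (hU : IsOpen U) {r t : ℝ}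
    (h : (r, t) ∈ U) : ∀ᶠ ρ in 𝓝 r, (ρ, t) ∈ U :=
  (Continuous.prodMk_left t).continuousAt.preimage_mem_nhds (hU.mem_nhds h)

open Filter Topology in
theorem eventually_vertical_mem {U : Set (ℝ × ℝ)} (hU : IsOpen U) {r t : ℝ}
    (h : (r, t) ∈ U) : ∀ᶠ s in 𝓝 t, (r, s) ∈ U :=
  (Continuous.prodMk_right r).continuousAt.preimage_mem_nhds (hU.mem_nhds h)

theorem DifferentiableAt.hasDerivAt_horizontal {G : ℝ × ℝ → ℝ} {r t : ℝ}
    (hG : DifferentiableAt ℝ G (r, t)) :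
    HasDerivAt (fun ρ => G (ρ, t)) (fderiv ℝ G (r, t) (1, 0)) r :=
  HasFDerivAt.comp_hasDerivAt (f := fun ρ : ℝ => (ρ, t)) r hG.hasFDerivAt
    ((hasDerivAt_id r).prodMk (hasDerivAt_const r t))

theorem DifferentiableAt.hasDerivAt_vertical {G : ℝ × ℝ → ℝ} {r t : ℝ}
    (hG : DifferentiableAt ℝ G (r, t)) :
    HasDerivAt (fun s => G (r, s)) (fderiv ℝ G (r, t) (0, 1)) t :=
  HasFDerivAt.comp_hasDerivAt (f := fun s : ℝ => (r, s)) t hG.hasFDerivAt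
    ((hasDerivAt_const t r).prodMk (hasDerivAt_id t))

theorem ContDiffOn.fderiv_apply_const {G : ℝ × ℝ → ℝ} {U : Set (ℝ × ℝ)} (hU : IsOpen U)
    {m n : WithTop ℕ∞} (hG : ContDiffOn ℝ n G U) (hmn : m + 1 ≤ n) (e : ℝ × ℝ) :
    ContDiffOn ℝ m (fun x => fderiv ℝ G x e) U :=
  (hG.fderiv_of_isOpen hU hmn).clm_apply contDiffOn_const

theorem ContDiffAt.fderiv_fderiv_apply_comm {G : ℝ × ℝ → ℝ} {x : ℝ × ℝ}
    (hG : ContDiffAt ℝ 2 G x) (a b : ℝ × ℝ) :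
    fderiv ℝ (fun y => fderiv ℝ G y a) x b = fderiv ℝ (fun y => fderiv ℝ G y b) x a := by
  have hd : DifferentiableAt ℝ (fderiv ℝ G) x :=
    (hG.fderiv_right (m := 1) (by norm_num)).differentiableAt (by norm_num)
  have key (c d : ℝ × ℝ) :
      fderiv ℝ (fun y => fderiv ℝ G y c) x d = fderiv ℝ (fderiv ℝ G) x d c := by
    rw [fderiv_clm_apply hd (differentiableAt_const c)]
    simp
  rw [key, key]
  exact (hG.isSymmSndFDerivAt (by simp)).eq b a

theorem deriv_zero_of_even {φ : ℝ → ℝ} (h : ∀ σ, φ (-σ) = φ σ) : deriv φ 0 = 0 := by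
  have h1 : deriv (fun σ => φ (-σ)) 0 = -deriv φ (-0) := deriv_comp_neg φ 0
  rw [funext h, neg_zero] at h1
  linarith

/-- If `u` is of class `C³` on an open set `U ⊆ (0,∞)×ℝ` with `0 < u_r < 1` and
`u_t = φ''(u_r)u_rr + φ'(u_r)/r` on `U`, then `v := φ'(1) - φ'(u_r)` satisfies
`0 < v < φ'(1)` and `v_t = g(v)·{v_rr + v_r/r - v/r² + φ'(1)/r²}` on `U`, where
`g(σ) = φ''((φ'|_{[0,1]})⁻¹(φ'(1) - σ))`. In particular, if `U ⊆ (r₁,r₂)×(0,T)`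
with `r₂ > 0`, then `v_t ≥ g(v)·{v_rr + f(r,t,v,v_r) + A}` on `U`, with
`f(r,t,p,q) := q/r - p/r²` and `A := φ'(1)/r₂²`. -/
theorem change_of_unknown_radial
    (φ : ℝ → ℝ) (hφ : ContDiff ℝ (⊤ : ℕ∞) φ) (hφeven : ∀ σ : ℝ, φ (-σ) = φ σ)
    (hφ2pos : ∀ σ : ℝ, 0 ≤ σ → σ < 1 → 0 < deriv (deriv φ) σ)
    (hφ2one : deriv (deriv φ) 1 = 0)
    (hφ2neg : ∀ σ : ℝ, 1 < σ → deriv (deriv φ) σ < 0)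
    (U : Set (ℝ × ℝ)) (hU : IsOpen U)
    (hUpos : U ⊆ Set.Ioi (0 : ℝ) ×ˢ Set.univ)
    (u : ℝ → ℝ → ℝ)
    (huC3 : ContDiffOn ℝ 3 (fun p : ℝ × ℝ => u p.1 p.2) U)
    (hsub : ∀ r t : ℝ, (r, t) ∈ U →
      0 < deriv (fun ρ => u ρ t) r ∧ deriv (fun ρ => u ρ t) r < 1)
    (heq : ∀ r t : ℝ, (r, t) ∈ U →
      deriv (fun s => u r s) t =
        deriv (deriv φ) (deriv (fun ρ => u ρ t) r) *
          deriv (fun ρ => deriv (fun z => u z t) ρ) r +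
        deriv φ (deriv (fun ρ => u ρ t) r) / r)
    (φinv : ℝ → ℝ)
    (hinv : Set.InvOn φinv (deriv φ) (Set.Icc 0 1) (Set.Icc 0 (deriv φ 1)))
    (hmap : Set.MapsTo φinv (Set.Icc 0 (deriv φ 1)) (Set.Icc 0 1))
    (r₁ r₂ T : ℝ) :
    ∀ r t : ℝ, (r, t) ∈ U →
      (0 < pmV φ u r t ∧ pmV φ u r t < deriv φ 1) ∧
      DifferentiableAt ℝ (fun ρ => pmV φ u ρ t) r ∧
      DifferentiableAt ℝ (fun ρ => deriv (fun z => pmV φ u z t) ρ) r ∧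
      HasDerivAt (fun s => pmV φ u r s)
        (deriv (deriv φ) (φinv (deriv φ 1 - pmV φ u r t)) *
          (deriv (fun ρ => deriv (fun z => pmV φ u z t) ρ) r +
            deriv (fun z => pmV φ u z t) r / r -
            pmV φ u r t / r ^ 2 + deriv φ 1 / r ^ 2)) t ∧
      (U ⊆ Set.Ioo r₁ r₂ ×ˢ Set.Ioo 0 T → 0 < r₂ →
        deriv (deriv φ) (φinv (deriv φ 1 - pmV φ u r t)) *
          (deriv (fun ρ => deriv (fun z => pmV φ u z t) ρ) r +
            (deriv (fun z => pmV φ u z t) r / r - pmV φ u r t / r ^ 2) +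
            deriv φ 1 / r₂ ^ 2) ≤
        deriv (deriv φ) (φinv (deriv φ 1 - pmV φ u r t)) *
          (deriv (fun ρ => deriv (fun z => pmV φ u z t) ρ) r +
            deriv (fun z => pmV φ u z t) r / r -
            pmV φ u r t / r ^ 2 + deriv φ 1 / r ^ 2)) := by
  intro r t hrt
  set F : ℝ × ℝ → ℝ := fun p => u p.1 p.2
  set P : ℝ × ℝ → ℝ := fun x => fderiv ℝ F x (1, 0)
  set Q : ℝ × ℝ → ℝ := fun x => fderiv ℝ F x (0, 1)
  set W : ℝ × ℝ → ℝ := fun x => deriv φ (P x)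
  set R : ℝ × ℝ → ℝ := fun x => fderiv ℝ W x (1, 0)
  have hφ' : ContDiff ℝ 2 (deriv φ) :=
    contDiff_infty.1 (contDiff_infty_iff_deriv.1 hφ).2 2
  have hφd (σ : ℝ) : HasDerivAt (deriv φ) (deriv (deriv φ) σ) σ :=
    (hφ'.differentiable (by norm_num) σ).hasDerivAt
  have hPc : ContDiffOn ℝ 2 P U := huC3.fderiv_apply_const hU (by norm_num) _
  have hQc : ContDiffOn ℝ 2 Q U := huC3.fderiv_apply_const hU (by norm_num) _
  have hWc : ContDiffOn ℝ 2 W U := hφ'.comp_contDiffOn hPc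
  have hRc : ContDiffOn ℝ 1 R U := hWc.fderiv_apply_const hU (by norm_num) _
  have hFd {x} (hx : x ∈ U) : DifferentiableAt ℝ F x :=
    (huC3.contDiffAt (hU.mem_nhds hx)).differentiableAt (by norm_num)
  have hPd {x} (hx : x ∈ U) : DifferentiableAt ℝ P x :=
    (hPc.contDiffAt (hU.mem_nhds hx)).differentiableAt (by norm_num)
  have hQd {x} (hx : x ∈ U) : DifferentiableAt ℝ Q x :=
    (hQc.contDiffAt (hU.mem_nhds hx)).differentiableAt (by norm_num)
  have hWd {x} (hx : x ∈ U) : DifferentiableAt ℝ W x :=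
    (hWc.contDiffAt (hU.mem_nhds hx)).differentiableAt (by norm_num)
  have hRd {x} (hx : x ∈ U) : DifferentiableAt ℝ R x :=
    (hRc.contDiffAt (hU.mem_nhds hx)).differentiableAt (by norm_num)
  have hur {a b} (h : (a, b) ∈ U) : deriv (fun ρ => u ρ b) a = P (a, b) :=
    (hFd h).hasDerivAt_horizontal.deriv
  have hut {a b} (h : (a, b) ∈ U) : deriv (fun s => u a s) b = Q (a, b) :=
    (hFd h).hasDerivAt_vertical.deriv
  have hurr {a b} (h : (a, b) ∈ U) :
      deriv (fun ρ => deriv (fun z => u z b) ρ) a = fderiv ℝ P (a, b) (1, 0) :=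
    ((hPd h).hasDerivAt_horizontal.congr_of_eventuallyEq
      ((eventually_horizontal_mem hU h).mono fun ρ hρ => hur hρ)).deriv
  have hRP {a b} (h : (a, b) ∈ U) :
      R (a, b) = deriv (deriv φ) (P (a, b)) * fderiv ℝ P (a, b) (1, 0) :=
    (hWd h).hasDerivAt_horizontal.unique
      (HasDerivAt.comp (h₂ := deriv φ) (h := fun ρ => P (ρ, b)) a (hφd _)
        (hPd h).hasDerivAt_horizontal)
  have hQR {a b} (h : (a, b) ∈ U) : Q (a, b) = R (a, b) + W (a, b) / a := by
    rw [← hut h, heq a b h, hur h, hurr h, hRP h]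
  have hv {a b} (h : (a, b) ∈ U) : pmV φ u a b = deriv φ 1 - W (a, b) := by
    rw [pmV, hur h]
  have hvr {a b} (h : (a, b) ∈ U) : HasDerivAt (fun ρ => pmV φ u ρ b) (-R (a, b)) a :=
    ((hWd h).hasDerivAt_horizontal.const_sub (deriv φ 1)).congr_of_eventuallyEq
      ((eventually_horizontal_mem hU h).mono fun ρ hρ => hv hρ)
  have hvrr : HasDerivAt (fun ρ => deriv (fun z => pmV φ u z t) ρ)
      (-fderiv ℝ R (r, t) (1, 0)) r :=
    (hRd hrt).hasDerivAt_horizontal.neg.congr_of_eventuallyEq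
      ((eventually_horizontal_mem hU hrt).mono fun ρ hρ => (hvr hρ).deriv)
  have hr : 0 < r := (hUpos hrt).1
  have hQr : fderiv ℝ Q (r, t) (1, 0) =
      fderiv ℝ R (r, t) (1, 0) + (R (r, t) * r - W (r, t) * 1) / r ^ 2 :=
    (hQd hrt).hasDerivAt_horizontal.unique
      (((hRd hrt).hasDerivAt_horizontal.add
        ((hWd hrt).hasDerivAt_horizontal.div (hasDerivAt_id r) hr.ne')).congr_of_eventuallyEq
        ((eventually_horizontal_mem hU hrt).mono fun ρ hρ => hQR hρ))
  have hPQ : fderiv ℝ P (r, t) (0, 1) = fderiv ℝ Q (r, t) (1, 0) :=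
    ((huC3.contDiffAt (hU.mem_nhds hrt)).of_le (by norm_num)).fderiv_fderiv_apply_comm _ _
  have hvt : HasDerivAt (fun s => pmV φ u r s)
      (-(deriv (deriv φ) (P (r, t)) * fderiv ℝ P (r, t) (0, 1))) t :=
    ((HasDerivAt.comp (h₂ := deriv φ) (h := fun s => P (r, s)) t (hφd _)
      (hPd hrt).hasDerivAt_vertical).const_sub (deriv φ 1)).congr_of_eventuallyEq
      ((eventually_vertical_mem hU hrt).mono fun s hs => hv hs)
  obtain ⟨hp0, hp1⟩ := hsub r t hrt
  rw [hur hrt] at hp0 hp1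
  have hmono : StrictMonoOn (deriv φ) (Set.Icc 0 1) := by
    refine strictMonoOn_of_deriv_pos (convex_Icc 0 1) hφ'.continuous.continuousOn fun x hx => ?_
    rw [interior_Icc] at hx
    exact hφ2pos x hx.1.le hx.2
  have hpI : P (r, t) ∈ Set.Icc (0 : ℝ) 1 := ⟨hp0.le, hp1.le⟩
  have hW0 : 0 < W (r, t) := by
    have := hmono (Set.left_mem_Icc.2 zero_le_one) hpI hp0
    rwa [deriv_zero_of_even hφeven] at this
  have hW1 : W (r, t) < deriv φ 1 := hmono hpI (Set.right_mem_Icc.2 zero_le_one) hp1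
  have hg : φinv (deriv φ 1 - pmV φ u r t) = P (r, t) := by
    rw [hv hrt, sub_sub_cancel]
    exact hinv.1 hpI
  rw [hg]
  refine ⟨?_, (hvr hrt).differentiableAt, hvrr.differentiableAt, ?_, fun hUT hr₂ => ?_⟩
  · rw [hv hrt]
    constructor <;> linarith
  · convert hvt using 1
    rw [hvrr.deriv, (hvr hrt).deriv, hv hrt, hPQ, hQr]
    field_simp
    ring
  · have hrr : r < r₂ := (hUT hrt).1.2
    have hA : deriv φ 1 / r₂ ^ 2 ≤ deriv φ 1 / r ^ 2 :=
      div_le_div_of_nonneg_left (hW0.trans hW1).le (by positivity) (by gcongr)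
    exact mul_le_mul_of_nonneg_left (by linarith) (hφ2pos _ hp0.le hp1).le
end

section
/- Let φ : ℝ → ℝ be a C^∞ even function satisfying φ''(σ) > 0 for all σ ∈ [0,1), φ''(1) = 0, and φ''(σ) < 0 for all σ > 1. Let 0 < r₁ < r₃ < r₅ < r₂ and T > 0, and let u ∈ C¹((r₁,r₂)×[0,T)) solve the radial equation u_t = (φ'(u_r))_r + φ'(u_r)/r on (r₁,r₂)×[0,T). Assume that: (i) |u_r(r₃,t)| < 1 and |u_r(r₅,t)| < 1 for all t ∈ [0,T); (ii) on the open set where u_r > 1, the function v := u_r is of class C^{2,1} and satisfies v_t = φ''(v)v_rr + φ'''(v)v_r² + (φ''(v)/r)v_r − φ'(v)/r². Define M(t) := max{ u_r(r,t) : r ∈ [r₃,r₅] }. Then for every t ∈ [0,T) such that M(0) − (φ'(1)/r₁²)·t > 1, one has M(t) ≥ M(0) − (φ'(1)/r₁²)·t. -/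
open Set Filter Topology

/-- At a local maximum, the second derivative is nonpositive. -/
theorem IsLocalMax.second_deriv_nonpos {f f' : ℝ → ℝ} {f'' x : ℝ} (hmax : IsLocalMax f x)
    (hf : ∀ᶠ y in 𝓝 x, HasDerivAt f (f' y) y) (hf' : HasDerivAt f' f'' x) : f'' ≤ 0 := by
  by_contra! hpos
  have hderiv : deriv f =ᶠ[𝓝 x] f' := hf.mono fun y hy => hy.deriv
  have hdd : deriv (deriv f) x = f'' := (hf'.congr_of_eventuallyEq hderiv).deriv
  have hmin : IsLocalMin f x :=
    isLocalMin_of_deriv_deriv_pos (by rwa [hdd]) hmax.deriv_eq_zero hf.self_of_nhds.continuousAt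
  have hconst : f =ᶠ[𝓝 x] fun _ => f x := by
    filter_upwards [hmax, hmin] with y h₁ h₂ using le_antisymm h₁ h₂
  have hzero : deriv (deriv f) x = 0 := by
    rw [hconst.deriv.deriv_eq]
    simp
  linarith

/-- If the right derivative of `f` at `x` exceeds `m`, then `f` lies above the line of slope `m`
through `(x, f x)` at points arbitrarily close to `x` on the right. -/
theorem HasDerivWithinAt.exists_line_lt_of_lt_right {f : ℝ → ℝ} {f' m x y : ℝ}
    (hf : HasDerivWithinAt f f' (Ioi x) x) (hm : m < f') (hxy : x < y) :
    ∃ z ∈ Ioc x y, f x + m * (z - x) < f z := by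
  rw [hasDerivWithinAt_iff_tendsto_slope' self_notMem_Ioi] at hf
  obtain ⟨z, hz, hzI⟩ := ((hf.eventually_const_lt hm).and (Ioc_mem_nhdsGT hxy)).exists
  refine ⟨z, hzI, ?_⟩
  rw [slope_def_field, lt_div_iff₀ (sub_pos.2 hzI.1)] at hz
  linarith

theorem Function.Even.deriv_zero {f : ℝ → ℝ} (hf : Function.Even f) : deriv f 0 = 0 := by
  have h := deriv_comp_neg f 0
  rw [show (fun x => f (-x)) = f from funext hf, neg_zero] at h
  linarith

/-- estimate `est:M(t)`.
For a radial `C¹` solution of `u_t = (φ'(u_r))_r + φ'(u_r)/r` whose slope stays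
subcritical at `r₃` and `r₅`, and which is `C^{2,1}` in the region where `u_r > 1`
where `v = u_r` solves `v_t = φ''(v)v_rr + φ'''(v)v_r² + (φ''(v)/r)v_r - φ'(v)/r²`,
the maximal slope `M(t) = max{u_r(r,t) : r ∈ [r₃,r₅]}` satisfies
`M(t) ≥ M(0) - (φ'(1)/r₁²)t` as long as the right-hand side exceeds `1`. -/
theorem max_slope_decays_at_most_linearly
    (φ : ℝ → ℝ) (hφ : ContDiff ℝ (⊤ : ℕ∞) φ) (hφeven : ∀ σ : ℝ, φ (-σ) = φ σ)
    (hφ2pos : ∀ σ : ℝ, 0 ≤ σ → σ < 1 → 0 < deriv (deriv φ) σ)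
    (hφ2one : deriv (deriv φ) 1 = 0)
    (hφ2neg : ∀ σ : ℝ, 1 < σ → deriv (deriv φ) σ < 0)
    (r₁ r₂ r₃ r₅ T : ℝ)
    (hr₁ : 0 < r₁) (h13 : r₁ < r₃) (h35 : r₃ < r₅) (h52 : r₅ < r₂) (hT : 0 < T)
    (u ur ut urr urrr urt : ℝ → ℝ → ℝ)
    -- `u` is of class `C¹` on `(r₁,r₂)×[0,T)`: the partial derivatives exist ...
    (hur : ∀ r t : ℝ, r ∈ Set.Ioo r₁ r₂ → t ∈ Set.Ico 0 T →
      HasDerivAt (fun ρ => u ρ t) (ur r t) r)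
    (hut : ∀ r t : ℝ, r ∈ Set.Ioo r₁ r₂ → t ∈ Set.Ico 0 T →
      HasDerivWithinAt (fun s => u r s) (ut r t) (Set.Ico 0 T) t)
    -- ... and `u`, `u_r`, `u_t` are continuous on `(r₁,r₂)×[0,T)`
    (huC : ContinuousOn (fun p : ℝ × ℝ => u p.1 p.2) (Set.Ioo r₁ r₂ ×ˢ Set.Ico 0 T))
    (hurC : ContinuousOn (fun p : ℝ × ℝ => ur p.1 p.2) (Set.Ioo r₁ r₂ ×ˢ Set.Ico 0 T))
    (hutC : ContinuousOn (fun p : ℝ × ℝ => ut p.1 p.2) (Set.Ioo r₁ r₂ ×ˢ Set.Ico 0 T))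
    -- the radial equation `u_t = (φ'(u_r))_r + φ'(u_r)/r`
    (heq : ∀ r t : ℝ, r ∈ Set.Ioo r₁ r₂ → t ∈ Set.Ico 0 T →
      HasDerivAt (fun ρ => deriv φ (ur ρ t)) (ut r t - deriv φ (ur r t) / r) r)
    -- (i) the slope is subcritical at `r₃` and at `r₅` for all times
    (hsub : ∀ t ∈ Set.Ico (0 : ℝ) T, |ur r₃ t| < 1 ∧ |ur r₅ t| < 1)
    -- (ii) on the open set where `u_r > 1`, `v := u_r` is `C^{2,1}` ...
    (hurr : ∀ r t : ℝ, r ∈ Set.Ioo r₁ r₂ → t ∈ Set.Ico 0 T → 1 < ur r t →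
      HasDerivAt (fun ρ => ur ρ t) (urr r t) r)
    (hurrr : ∀ r t : ℝ, r ∈ Set.Ioo r₁ r₂ → t ∈ Set.Ico 0 T → 1 < ur r t →
      HasDerivAt (fun ρ => urr ρ t) (urrr r t) r)
    (hurt : ∀ r t : ℝ, r ∈ Set.Ioo r₁ r₂ → t ∈ Set.Ico 0 T → 1 < ur r t →
      HasDerivWithinAt (fun s => ur r s) (urt r t) (Set.Ico 0 T) t)
    (hurrC : ContinuousOn (fun p : ℝ × ℝ => urr p.1 p.2)
      {p : ℝ × ℝ | p.1 ∈ Set.Ioo r₁ r₂ ∧ p.2 ∈ Set.Ico 0 T ∧ 1 < ur p.1 p.2})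
    (hurrrC : ContinuousOn (fun p : ℝ × ℝ => urrr p.1 p.2)
      {p : ℝ × ℝ | p.1 ∈ Set.Ioo r₁ r₂ ∧ p.2 ∈ Set.Ico 0 T ∧ 1 < ur p.1 p.2})
    (hurtC : ContinuousOn (fun p : ℝ × ℝ => urt p.1 p.2)
      {p : ℝ × ℝ | p.1 ∈ Set.Ioo r₁ r₂ ∧ p.2 ∈ Set.Ico 0 T ∧ 1 < ur p.1 p.2})
    -- ... and satisfies `v_t = φ''(v)v_rr + φ'''(v)v_r² + (φ''(v)/r)v_r - φ'(v)/r²`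
    (hveq : ∀ r t : ℝ, r ∈ Set.Ioo r₁ r₂ → t ∈ Set.Ico 0 T → 1 < ur r t →
      urt r t = deriv (deriv φ) (ur r t) * urrr r t +
        deriv (deriv (deriv φ)) (ur r t) * (urr r t) ^ 2 +
        deriv (deriv φ) (ur r t) / r * urr r t -
        deriv φ (ur r t) / r ^ 2) :
    ∀ t ∈ Set.Ico (0 : ℝ) T,
      1 < sSup ((fun r => ur r 0) '' Set.Icc r₃ r₅) - deriv φ 1 / r₁ ^ 2 * t →
      sSup ((fun r => ur r 0) '' Set.Icc r₃ r₅) - deriv φ 1 / r₁ ^ 2 * t ≤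
        sSup ((fun r => ur r t) '' Set.Icc r₃ r₅) := by
  intro t ht h1
  have hφ' : ContDiff ℝ (⊤ : ℕ∞) (deriv φ) := (contDiff_infty_iff_deriv.1 hφ).2
  have hφ1 : 0 < deriv φ 1 := by
    rw [← Function.Even.deriv_zero hφeven]
    refine strictMonoOn_of_deriv_pos (convex_Icc 0 1) hφ'.continuous.continuousOn
      (fun σ hσ => ?_) (by simp) (by simp) one_pos
    rw [interior_Icc] at hσ
    exact hφ2pos σ hσ.1.le hσ.2
  have hφlt : ∀ σ, 1 < σ → deriv φ σ < deriv φ 1 := fun σ hσ => by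
    refine strictAntiOn_of_deriv_neg (convex_Ici 1) hφ'.continuous.continuousOn
      (fun τ hτ => ?_) (by simp) hσ.le hσ
    rw [interior_Ici] at hτ
    exact hφ2neg τ hτ
  set c := deriv φ 1 / r₁ ^ 2 with hc
  have hc0 : 0 < c := by positivity
  set M₀ := sSup ((fun r => ur r 0) '' Icc r₃ r₅) with hM₀
  have hIcc : Icc r₃ r₅ ⊆ Ioo r₁ r₂ := fun r hr => ⟨h13.trans_le hr.1, hr.2.trans_lt h52⟩
  have hne : (Icc r₃ r₅).Nonempty := nonempty_Icc.2 h35.le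
  have hslice : ∀ s ∈ Ico 0 T, ContinuousOn (fun r => ur r s) (Ioo r₁ r₂) := fun s hs =>
    hurC.comp (f := fun r => (r, s)) (by fun_prop) fun r hr => ⟨hr, hs⟩
  -- at an interior spatial maximum above `1`, the slope decreases slower than at rate `c`
  have hrate : ∀ r ∈ Icc r₃ r₅, ∀ s ∈ Ico 0 T, 1 < ur r s →
      IsMaxOn (fun ρ => ur ρ s) (Icc r₃ r₅) r → -c < urt r s := by
    intro r hr s hs hv hmax
    have hr' := hIcc hr
    have h3 : r₃ ≠ r := by
      rintro rfl
      linarith [(abs_lt.1 (hsub s hs).1).2]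
    have h5 : r ≠ r₅ := by
      rintro rfl
      linarith [(abs_lt.1 (hsub s hs).2).2]
    have hloc : IsLocalMax (fun ρ => ur ρ s) r :=
      hmax.isLocalMax (Icc_mem_nhds (hr.1.lt_of_ne h3) (hr.2.lt_of_ne h5))
    have hnhds := isOpen_Ioo.mem_nhds hr'
    have hd : ∀ᶠ ρ in 𝓝 r, HasDerivAt (fun ρ => ur ρ s) (urr ρ s) ρ := by
      filter_upwards [hnhds, ((hslice s hs).continuousAt hnhds).eventually_const_lt hv]
        with ρ hρ hρv using hurr ρ s hρ hs hρv
    have hrr : urr r s = 0 := hloc.hasDerivAt_eq_zero (hurr r s hr' hs hv)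
    have hrrr : urrr r s ≤ 0 := hloc.second_deriv_nonpos hd (hurrr r s hr' hs hv)
    have hdiff : 0 ≤ deriv (deriv φ) (ur r s) * urrr r s :=
      mul_nonneg_of_nonpos_of_nonpos (hφ2neg _ hv).le hrrr
    have hr0 : 0 < r := hr₁.trans hr'.1
    have hzero : deriv φ (ur r s) / r ^ 2 < c := calc
      deriv φ (ur r s) / r ^ 2 < deriv φ 1 / r ^ 2 := by
        have := hφlt _ hv
        gcongr
      _ ≤ c := by
        have := hr'.1.le
        rw [hc]
        gcongr
    rw [hveq r s hr' hs hv, hrr]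
    simp only [ne_eq, OfNat.ofNat_ne_zero, not_false_eq_true, zero_pow, mul_zero, add_zero]
    linarith
  -- the times at which the claimed lower bound holds
  let S : Set ℝ := {s | ∃ r ∈ Icc r₃ r₅, M₀ - c * s ≤ ur r s}
  have hsT : ∀ s ∈ Icc 0 t, s ∈ Ico 0 T := fun s hs => ⟨hs.1, hs.2.trans_lt ht.2⟩
  have hclosed : IsClosed (S ∩ Icc 0 t) := by
    have hK : IsCompact (Icc r₃ r₅ ×ˢ Icc 0 t) := isCompact_Icc.prod isCompact_Icc
    have hcont : ContinuousOn (fun p : ℝ × ℝ => ur p.1 p.2 + c * p.2) (Icc r₃ r₅ ×ˢ Icc 0 t) :=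
      (hurC.mono (prod_mono hIcc hsT)).add (by fun_prop)
    have hF := hcont.preimage_isClosed_of_isClosed hK.isClosed (isClosed_Ici (a := M₀))
    convert ((hK.of_isClosed_subset hF inter_subset_left).image continuous_snd).isClosed using 1
    ext s
    constructor
    · rintro ⟨⟨r, hr, hs⟩, hst⟩
      exact ⟨(r, s), ⟨⟨hr, hst⟩, sub_le_iff_le_add.1 hs⟩, rfl⟩
    · rintro ⟨⟨r, s⟩, ⟨⟨hr, hst⟩, hs⟩, rfl⟩
      exact ⟨⟨r, hr, sub_le_iff_le_add.2 hs⟩, hst⟩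
  have h0 : (0 : ℝ) ∈ S := by
    obtain ⟨r, hr, h⟩ := isCompact_Icc.exists_sSup_image_eq hne
      ((hslice 0 ⟨le_rfl, hT⟩).mono hIcc)
    exact ⟨r, hr, by rw [hM₀, h]; simp⟩
  have hstep : ∀ s ∈ S ∩ Ico 0 t, ∀ y ∈ Ioi s, (S ∩ Ioc s y).Nonempty := by
    rintro s ⟨⟨r', hr', hs⟩, hst⟩ y hy
    have hsI := hsT s (Ico_subset_Icc_self hst)
    obtain ⟨r, hr, hmax⟩ := isCompact_Icc.exists_isMaxOn hne ((hslice s hsI).mono hIcc)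
    have hle : M₀ - c * s ≤ ur r s := hs.trans (hmax hr')
    have hv : 1 < ur r s := by nlinarith [hst.2]
    have hder : HasDerivWithinAt (fun τ => ur r τ) (urt r s) (Ioi s) s :=
      (hurt r s (hIcc hr) hsI hv).mono_of_mem_nhdsWithin
        (mem_of_superset (Ioo_mem_nhdsGT hsI.2) fun τ hτ => ⟨hsI.1.trans hτ.1.le, hτ.2⟩)
    obtain ⟨z, hz, hlt⟩ := hder.exists_line_lt_of_lt_right (hrate r hr s hsI hv hmax) hy
    exact ⟨z, ⟨r, hr, by linarith⟩, hz⟩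
  obtain ⟨r, hr, h⟩ := hclosed.Icc_subset_of_forall_exists_gt h0 hstep (right_mem_Icc.2 ht.1)
  exact h.trans (le_csSup (isCompact_Icc.bddAbove_image ((hslice t ht).mono hIcc))
    (mem_image_of_mem _ hr))
end
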